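/- arXiv:0806.3013 — 3 statements merged into one kernel-verified Lean document; each statement's English description precedes it below -/
import Mathlib

section
/- Let R and S be unital rings, let ℋ_r be a Gabriel filter of right ideals of S and 𝔇_l a Gabriel filter of left ideals of R. Then the set _lΩ_r of right ideals of S ⊗_ℤ R^op that contain an ideal of the form H ⊗ R^op + S ⊗ D with H ∈ ℋ_r and D ∈ 𝔇_l is a Gabriel filter of right ideals of S ⊗_ℤ R^op. -/
open scoped TensorProduct
open MulOpposite

universe u v

set_option autoImplicit false

/-! ### Gabriel filters -/

section Colon
variable {R : Type u} [Ring R]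

/-- For a right ideal `I` and `r : R`, the right ideal `(I : r) = {x | r * x ∈ I}`. -/
def rightColon (I : Submodule Rᵐᵒᵖ R) (r : R) : Submodule Rᵐᵒᵖ R where
  carrier := {x | r * x ∈ I}
  add_mem' := by intro a b ha hb; simpa [mul_add] using add_mem ha hb
  zero_mem' := by simp
  smul_mem' := by
    intro c x hx
    have : c • (r * x) ∈ I := I.smul_mem c hx
    simpa [MulOpposite.smul_eq_mul_unop, mul_assoc] using this

/-- For a left ideal `I` and `r : R`, the left ideal `(I : r) = {x | x * r ∈ I}`. -/
def leftColon (I : Submodule R R) (r : R) : Submodule R R where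
  carrier := {x | x * r ∈ I}
  add_mem' := by intro a b ha hb; simpa [add_mul] using add_mem ha hb
  zero_mem' := by simp
  smul_mem' := by
    intro c x hx
    have : c • (x * r) ∈ I := I.smul_mem c hx
    simpa [smul_eq_mul, mul_assoc] using this

end Colon

/-- A Gabriel filter of right ideals of `R` (right ideals are `Rᵐᵒᵖ`-submodules of `R`). -/
structure RGF (R : Type u) [Ring R] where
  s : Set (Submodule Rᵐᵒᵖ R)
  top_mem : ⊤ ∈ s
  up : ∀ {I J : Submodule Rᵐᵒᵖ R}, I ∈ s → I ≤ J → J ∈ s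
  inf_mem : ∀ {I J : Submodule Rᵐᵒᵖ R}, I ∈ s → J ∈ s → I ⊓ J ∈ s
  colon_mem : ∀ {I : Submodule Rᵐᵒᵖ R} (r : R), I ∈ s → rightColon I r ∈ s
  t4 : ∀ (J : Submodule Rᵐᵒᵖ R), (∃ I ∈ s, ∀ r ∈ I, rightColon J r ∈ s) → J ∈ s

/-- A Gabriel filter of left ideals of `R`. -/
structure LGF (R : Type u) [Ring R] where
  s : Set (Submodule R R)
  top_mem : ⊤ ∈ s
  up : ∀ {I J : Submodule R R}, I ∈ s → I ≤ J → J ∈ s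
  inf_mem : ∀ {I J : Submodule R R}, I ∈ s → J ∈ s → I ⊓ J ∈ s
  colon_mem : ∀ {I : Submodule R R} (r : R), I ∈ s → leftColon I r ∈ s
  t4 : ∀ (J : Submodule R R), (∃ I ∈ s, ∀ r ∈ I, leftColon J r ∈ s) → J ∈ s

/-! ### Torsion predicates w.r.t. a set of (left/right) ideals -/

section Torsion
variable {R : Type u} [Ring R]

/-- `X` is a torsion right `R`-module with respect to the filter `F` of right ideals. -/
def RTor (F : Set (Submodule Rᵐᵒᵖ R)) (X : Type v) [AddCommGroup X] [Module Rᵐᵒᵖ X] : Prop :=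
  ∀ x : X, ∃ I ∈ F, ∀ a ∈ I, op a • x = 0

/-- `X` is a torsion-free right `R`-module with respect to `F`. -/
def RTorFree (F : Set (Submodule Rᵐᵒᵖ R)) (X : Type v) [AddCommGroup X] [Module Rᵐᵒᵖ X] : Prop :=
  ∀ x : X, (∃ I ∈ F, ∀ a ∈ I, op a • x = 0) → x = 0

/-- `X` is a torsion left `R`-module with respect to the filter `F` of left ideals. -/
def LTor (F : Set (Submodule R R)) (X : Type v) [AddCommGroup X] [Module R X] : Prop :=
  ∀ x : X, ∃ I ∈ F, ∀ a ∈ I, a • x = 0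

/-- `X` is a torsion-free left `R`-module with respect to `F`. -/
def LTorFree (F : Set (Submodule R R)) (X : Type v) [AddCommGroup X] [Module R X] : Prop :=
  ∀ x : X, (∃ I ∈ F, ∀ a ∈ I, a • x = 0) → x = 0

end Torsion

/-! ### Dense ideals, Ore filters -/

section Dense
variable (R : Type u) [Ring R]

/-- The set of dense right ideals of `R`. -/
def denseR : Set (Submodule Rᵐᵒᵖ R) :=
  {I | ∀ x y : R, x ≠ 0 → ∃ r : R, y * r ∈ I ∧ x * r ≠ 0}

/-- The set of dense left ideals of `R`. -/
def denseL : Set (Submodule R R) :=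
  {I | ∀ x y : R, x ≠ 0 → ∃ r : R, r * y ∈ I ∧ r * x ≠ 0}

/-- The Gabriel filter of right ideals containing `sR` for some `s ∈ S`. -/
def oreR (S : Submonoid R) : Set (Submodule Rᵐᵒᵖ R) :=
  {I | ∃ s ∈ S, ∀ r : R, s * r ∈ I}

/-- The Gabriel filter of left ideals containing `Rs` for some `s ∈ S`. -/
def oreL (S : Submonoid R) : Set (Submodule R R) :=
  {I | ∃ s ∈ S, ∀ r : R, r * s ∈ I}

end Dense

/-! ## Statement 0

Let `R` and `S` be unital rings, `ℋ_r` a Gabriel filter of right ideals of `S` and `𝔇_l` a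
Gabriel filter of left ideals of `R`. Then the set `_lΩ_r` of right ideals of `S ⊗_ℤ R^op`
containing an ideal of the form `H ⊗ R^op + S ⊗ D` (`H ∈ ℋ_r`, `D ∈ 𝔇_l`) is a Gabriel
filter of right ideals of `S ⊗_ℤ R^op`. -/

section Stmt0
variable {R S : Type u} [Ring R] [Ring S]

/-- The set `_lΩ_r` of right ideals of `S ⊗_ℤ R^op` containing an ideal of the form
`H ⊗ R^op + S ⊗ D` with `H ∈ ℋ_r` and `D ∈ 𝔇_l`. -/
def OmegaSet (Hr : RGF S) (Dl : LGF R) :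
    Set (Submodule (TensorProduct ℤ S Rᵐᵒᵖ)ᵐᵒᵖ (TensorProduct ℤ S Rᵐᵒᵖ)) :=
  {K | ∃ H ∈ Hr.s, ∃ D ∈ Dl.s,
    Submodule.span (TensorProduct ℤ S Rᵐᵒᵖ)ᵐᵒᵖ
      ({z : TensorProduct ℤ S Rᵐᵒᵖ | ∃ h ∈ H, ∃ r : Rᵐᵒᵖ, z = h ⊗ₜ[ℤ] r} ∪
       {z : TensorProduct ℤ S Rᵐᵒᵖ | ∃ s : S, ∃ d ∈ D, z = s ⊗ₜ[ℤ] (op d)}) ≤ K}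

/-- The right ideal `{s | s ⊗ 1 ∈ K}` of `S`. -/
def comapLeft (K : Submodule (TensorProduct ℤ S Rᵐᵒᵖ)ᵐᵒᵖ (TensorProduct ℤ S Rᵐᵒᵖ)) :
    Submodule Sᵐᵒᵖ S where
  carrier := {s | s ⊗ₜ[ℤ] (1 : Rᵐᵒᵖ) ∈ K}
  add_mem' := by
    intro a b ha hb
    simpa [TensorProduct.add_tmul] using add_mem ha hb
  zero_mem' := by simp
  smul_mem' := by
    intro c x hx
    simpa [MulOpposite.smul_eq_mul_unop] using K.smul_mem (op (c.unop ⊗ₜ[ℤ] (1 : Rᵐᵒᵖ))) hx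

/-- The left ideal `{d | 1 ⊗ d ∈ K}` of `R`. -/
def comapRight (K : Submodule (TensorProduct ℤ S Rᵐᵒᵖ)ᵐᵒᵖ (TensorProduct ℤ S Rᵐᵒᵖ)) :
    Submodule R R where
  carrier := {d | (1 : S) ⊗ₜ[ℤ] op d ∈ K}
  add_mem' := by
    intro a b ha hb
    simpa [TensorProduct.tmul_add] using add_mem ha hb
  zero_mem' := by simp
  smul_mem' := by
    intro c x hx
    simpa [MulOpposite.smul_eq_mul_unop] using K.smul_mem (op ((1 : S) ⊗ₜ[ℤ] op c)) hx

section Comap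
variable {K : Submodule (TensorProduct ℤ S Rᵐᵒᵖ)ᵐᵒᵖ (TensorProduct ℤ S Rᵐᵒᵖ)}

theorem tmul_mem_of_mem_comapLeft {s : S} (hs : s ∈ comapLeft K) (r : Rᵐᵒᵖ) :
    s ⊗ₜ[ℤ] r ∈ K := by
  have hs' : s ⊗ₜ[ℤ] (1 : Rᵐᵒᵖ) ∈ K := hs
  simpa [MulOpposite.smul_eq_mul_unop] using K.smul_mem (op ((1 : S) ⊗ₜ[ℤ] r)) hs'

theorem tmul_mem_of_mem_comapRight {d : R} (hd : d ∈ comapRight K) (s : S) :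
    s ⊗ₜ[ℤ] op d ∈ K := by
  have hd' : (1 : S) ⊗ₜ[ℤ] op d ∈ K := hd
  simpa [MulOpposite.smul_eq_mul_unop] using K.smul_mem (op (s ⊗ₜ[ℤ] (1 : Rᵐᵒᵖ))) hd'

theorem mem_omegaSet_iff {Hr : RGF S} {Dl : LGF R} :
    K ∈ OmegaSet Hr Dl ↔ comapLeft K ∈ Hr.s ∧ comapRight K ∈ Dl.s := by
  constructor
  · rintro ⟨H, hH, D, hD, hle⟩
    exact ⟨Hr.up hH fun h hh => hle (Submodule.subset_span (Or.inl ⟨h, hh, 1, rfl⟩)),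
      Dl.up hD fun d hd => hle (Submodule.subset_span (Or.inr ⟨1, d, hd, rfl⟩))⟩
  · rintro ⟨hH, hD⟩
    refine ⟨_, hH, _, hD, Submodule.span_le.2 ?_⟩
    rintro _ (⟨h, hh, r, rfl⟩ | ⟨s, d, hd, rfl⟩)
    · exact tmul_mem_of_mem_comapLeft hh r
    · exact tmul_mem_of_mem_comapRight hd s

theorem rightColon_comapLeft_le (s : S) (r : Rᵐᵒᵖ) :
    rightColon (comapLeft K) s ≤ comapLeft (rightColon (R := TensorProduct ℤ S Rᵐᵒᵖ) K (s ⊗ₜ[ℤ] r)) := by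
  intro x hx
  change s ⊗ₜ[ℤ] r * x ⊗ₜ[ℤ] (1 : Rᵐᵒᵖ) ∈ K
  simpa using tmul_mem_of_mem_comapLeft (K := K) (s := s * x) hx r

theorem leftColon_comapRight_le (s : S) (r : R) :
    leftColon (comapRight K) r ≤ comapRight (rightColon (R := TensorProduct ℤ S Rᵐᵒᵖ) K (s ⊗ₜ[ℤ] op r)) := by
  intro x hx
  change s ⊗ₜ[ℤ] op r * (1 : S) ⊗ₜ[ℤ] op x ∈ K
  simpa using tmul_mem_of_mem_comapRight (K := K) (d := x * r) hx s

theorem comapLeft_rightColon_tmul_one (s : S) :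
    comapLeft (rightColon (R := TensorProduct ℤ S Rᵐᵒᵖ) K (s ⊗ₜ[ℤ] (1 : Rᵐᵒᵖ))) = rightColon (comapLeft K) s := by
  refine le_antisymm (fun x hx => ?_) (rightColon_comapLeft_le s 1)
  have hx' : s ⊗ₜ[ℤ] (1 : Rᵐᵒᵖ) * x ⊗ₜ[ℤ] (1 : Rᵐᵒᵖ) ∈ K := hx
  change (s * x) ⊗ₜ[ℤ] (1 : Rᵐᵒᵖ) ∈ K
  simpa using hx'

theorem comapRight_rightColon_one_tmul (r : R) :
    comapRight (rightColon (R := TensorProduct ℤ S Rᵐᵒᵖ) K ((1 : S) ⊗ₜ[ℤ] op r)) = leftColon (comapRight K) r := by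
  refine le_antisymm (fun x hx => ?_) (leftColon_comapRight_le 1 r)
  have hx' : (1 : S) ⊗ₜ[ℤ] op r * (1 : S) ⊗ₜ[ℤ] op x ∈ K := hx
  change (1 : S) ⊗ₜ[ℤ] op (x * r) ∈ K
  simpa using hx'

end Comap

section OmegaSet
variable {Hr : RGF S} {Dl : LGF R}
  {I J : Submodule (TensorProduct ℤ S Rᵐᵒᵖ)ᵐᵒᵖ (TensorProduct ℤ S Rᵐᵒᵖ)}

theorem OmegaSet.top_mem :
    (⊤ : Submodule (TensorProduct ℤ S Rᵐᵒᵖ)ᵐᵒᵖ (TensorProduct ℤ S Rᵐᵒᵖ)) ∈ OmegaSet Hr Dl :=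
  ⟨⊤, Hr.top_mem, ⊤, Dl.top_mem, le_top⟩

theorem OmegaSet.mem_of_le (hI : I ∈ OmegaSet Hr Dl) (hIJ : I ≤ J) : J ∈ OmegaSet Hr Dl := by
  obtain ⟨H, hH, D, hD, hle⟩ := hI
  exact ⟨H, hH, D, hD, hle.trans hIJ⟩

theorem OmegaSet.inf_mem (hI : I ∈ OmegaSet Hr Dl) (hJ : J ∈ OmegaSet Hr Dl) :
    I ⊓ J ∈ OmegaSet Hr Dl := by
  rw [mem_omegaSet_iff] at *
  exact ⟨Hr.inf_mem hI.1 hJ.1, Dl.inf_mem hI.2 hJ.2⟩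

theorem OmegaSet.rightColon_mem (z : TensorProduct ℤ S Rᵐᵒᵖ) (hI : I ∈ OmegaSet Hr Dl) :
    rightColon I z ∈ OmegaSet Hr Dl := by
  induction z using TensorProduct.induction_on with
  | zero =>
    refine mem_of_le top_mem fun x _ => ?_
    change 0 * x ∈ I
    simp
  | tmul s r =>
    rw [mem_omegaSet_iff] at *
    exact ⟨Hr.up (Hr.colon_mem s hI.1) (rightColon_comapLeft_le s r),
      Dl.up (Dl.colon_mem r.unop hI.2) (leftColon_comapRight_le s r.unop)⟩
  | add z w hz hw =>
    refine mem_of_le (inf_mem hz hw) fun x hx => ?_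
    change (z + w) * x ∈ I
    rw [add_mul]
    exact add_mem hx.1 hx.2

theorem OmegaSet.mem_of_rightColon_mem (hI : I ∈ OmegaSet Hr Dl)
    (h : ∀ z ∈ I, rightColon J z ∈ OmegaSet Hr Dl) : J ∈ OmegaSet Hr Dl := by
  rw [mem_omegaSet_iff] at hI ⊢
  refine ⟨Hr.t4 _ ⟨_, hI.1, fun s hs => ?_⟩, Dl.t4 _ ⟨_, hI.2, fun d hd => ?_⟩⟩
  · rw [← comapLeft_rightColon_tmul_one]
    exact (mem_omegaSet_iff.1 (h _ hs)).1
  · rw [← comapRight_rightColon_one_tmul]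
    exact (mem_omegaSet_iff.1 (h _ hd)).2

end OmegaSet

/-- `_lΩ_r` is a Gabriel filter of right ideals of `S ⊗_ℤ R^op`. -/
theorem omega_is_gabriel_filter (Hr : RGF S) (Dl : LGF R) :
    ∃ G : RGF (TensorProduct ℤ S Rᵐᵒᵖ), G.s = OmegaSet Hr Dl := by
  exact ⟨{
    s := OmegaSet Hr Dl
    top_mem := OmegaSet.top_mem
    up := OmegaSet.mem_of_le
    inf_mem := OmegaSet.inf_mem
    colon_mem := OmegaSet.rightColon_mem
    t4 := fun _ ⟨_, hI, h⟩ => OmegaSet.mem_of_rightColon_mem hI h }, rfl⟩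

end Stmt0
end

section
/- Let T : Mod-R → Mod-S be an equivalence of categories of right modules over unital rings R and S, and let I_dr(R) denote the Gabriel filter of dense right ideals of R. Then T♯(I_dr(R)) = I_dr(S), the Gabriel filter of dense right ideals of S. -/
open scoped TensorProduct
open MulOpposite

universe u v

set_option autoImplicit false

/-! ## Statement 8

Let `T : Mod-R → Mod-S` be an equivalence. Then `T♯(I_dr(R)) = I_dr(S)`: `T` carries
dense-torsion modules to dense-torsion modules and dense-torsion-free modules to
dense-torsion-free modules. -/

section Stmt8
open CategoryTheory
variable {R S : Type u} [Ring R] [Ring S]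

/-- A nonzero element of a projective module is detected by some linear functional. -/
lemma exists_linearMap_apply_ne_zero {A : Type u} [Ring A] {P : Type v} [AddCommGroup P]
    [Module A P] [Module.Projective A P] {p : P} (hp : p ≠ 0) : ∃ φ : P →ₗ[A] A, φ p ≠ 0 := by
  obtain ⟨s, hs⟩ := Module.projective_def.1 (inferInstance : Module.Projective A P)
  by_contra! h
  have hsp : s p = 0 := Finsupp.ext fun q => h (Finsupp.lapply q ∘ₗ s)
  exact hp (by rw [← hs p, hsp, map_zero])

lemma rightColon_mem_denseR {I : Submodule Rᵐᵒᵖ R} (hI : I ∈ denseR R) (r : R) :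
    rightColon I r ∈ denseR R := fun x y hx => by
  obtain ⟨t, ht, hxt⟩ := hI x (r * y) hx
  exact ⟨t, (mul_assoc r y t ▸ ht : r * (y * t) ∈ I), hxt⟩

/-- Dense-torsion modules are those all of whose submodules have no nonzero map to a projective
module. -/
lemma rTor_denseR_iff (X : ModuleCat.{u} Rᵐᵒᵖ) :
    RTor (denseR R) X ↔ ∀ (Y P : ModuleCat.{u} Rᵐᵒᵖ) (i : Y ⟶ X) (f : Y ⟶ P),
      Mono i → Projective P → f = 0 := by
  constructor
  · intro hX Y P i f hi hP
    have hP' : Module.Projective Rᵐᵒᵖ P := (IsProjective.iff_projective P).2 hP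
    have hinj := (ModuleCat.mono_iff_injective i).1 hi
    ext y
    by_contra hy
    obtain ⟨φ, hφ⟩ := exists_linearMap_apply_ne_zero (A := Rᵐᵒᵖ) (p := f.hom y) hy
    obtain ⟨I, hI, hann⟩ := hX (i.hom y)
    obtain ⟨r, hr, hne⟩ := hI (unop (φ (f.hom y))) 1 ((unop_ne_zero_iff _).2 hφ)
    have hry : op r • y = 0 := hinj (by
      simpa using hann r (by simpa using hr))
    apply hne
    have := congrArg (fun z => unop (φ (f.hom z))) hry
    simpa using this
  · intro h x
    let I : Submodule Rᵐᵒᵖ R :=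
      (LinearMap.ker (LinearMap.toSpanSingleton Rᵐᵒᵖ X x)).comap
        ({ toFun := op, map_add' := fun _ _ => rfl, map_smul' := fun _ _ => rfl } :
          R →ₗ[Rᵐᵒᵖ] Rᵐᵒᵖ)
    have hmem (a : R) : a ∈ I ↔ op a • x = 0 := Iff.rfl
    refine ⟨I, ?_, fun a ha => (hmem a).1 ha⟩
    intro a y ha
    by_contra! hy
    let t := LinearMap.toSpanSingleton Rᵐᵒᵖ X (op y • x)
    let g := LinearMap.toSpanSingleton Rᵐᵒᵖ Rᵐᵒᵖ (op a)
    have hker : LinearMap.ker t ≤ LinearMap.ker g := by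
      intro c hc
      have hc' : c • op y • x = 0 := hc
      have hac := hy (unop c) ((hmem _).2 (by simpa [mul_smul] using hc'))
      exact unop_injective hac
    let f : LinearMap.range t →ₗ[Rᵐᵒᵖ] Rᵐᵒᵖ :=
      (LinearMap.ker t).liftQ g hker ∘ₗ t.quotKerEquivRange.symm.toLinearMap
    have hf : f ⟨t 1, t.mem_range_self 1⟩ = op a := by
      simp only [f, LinearMap.comp_apply, LinearEquiv.coe_coe]
      rw [LinearMap.quotKerEquivRange_symm_apply_image]
      simp [g]
    have hf0 := h (.of _ (LinearMap.range t)) (.of _ Rᵐᵒᵖ)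
      (ModuleCat.ofHom (LinearMap.range t).subtype) (ModuleCat.ofHom f)
      ((ModuleCat.mono_iff_injective _).2 Subtype.val_injective)
      ((IsProjective.iff_projective _).1 inferInstance)
    have hf1 : f = 0 := congrArg ModuleCat.Hom.hom hf0
    rw [hf1] at hf
    exact ha (op_injective hf.symm)

/-- Dense-torsion-free modules are those receiving no nonzero map from a dense-torsion module. -/
lemma rTorFree_denseR_iff (X : ModuleCat.{u} Rᵐᵒᵖ) :
    RTorFree (denseR R) X ↔ ∀ (Y : ModuleCat.{u} Rᵐᵒᵖ) (f : Y ⟶ X),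
      RTor (denseR R) Y → f = 0 := by
  constructor
  · intro hX Y f hY
    ext y
    obtain ⟨I, hI, hann⟩ := hY y
    exact hX _ ⟨I, hI, fun a ha => by rw [← map_smul, hann a ha, map_zero]⟩
  · rintro h x ⟨I, hI, hann⟩
    let t := LinearMap.toSpanSingleton Rᵐᵒᵖ X x
    have htor : RTor (denseR R) (LinearMap.range t) := by
      rintro ⟨_, c, rfl⟩
      refine ⟨rightColon I (unop c), rightColon_mem_denseR hI _, fun a ha => Subtype.ext ?_⟩
      have : op (unop c * a) • x = 0 := hann _ ha
      simpa [t, mul_smul] using this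
    have h0 := h (.of _ (LinearMap.range t)) (ModuleCat.ofHom (LinearMap.range t).subtype) htor
    have h1 : (LinearMap.range t).subtype = 0 := congrArg ModuleCat.Hom.hom h0
    simpa [t] using LinearMap.congr_fun h1 ⟨t 1, 1, rfl⟩

lemma rTor_denseR_functor_obj (e : ModuleCat.{u} Rᵐᵒᵖ ≌ ModuleCat.{u} Sᵐᵒᵖ)
    {X : ModuleCat.{u} Rᵐᵒᵖ} (hX : RTor (denseR R) X) :
    RTor (denseR S) (e.functor.obj X) := by
  rw [rTor_denseR_iff] at hX ⊢
  intro Y P i f hi hP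
  have := Functor.preservesZeroMorphisms_of_full e.inverse
  apply e.inverse.map_injective
  rw [Functor.map_zero]
  have hmono : Mono (e.inverse.map i) :=
    (Functor.preservesMonomorphisms_of_adjunction e.toAdjunction).preserves i
  have hiso : IsIso (e.unitIso.inv.app X) := NatIso.inv_app_isIso e.unitIso X
  have hmono' : Mono (e.unitIso.inv.app X) := IsIso.mono_of_iso _
  exact hX _ _ (e.inverse.map i ≫ e.unitIso.inv.app X) _ (mono_comp _ _)
    ((e.symm.map_projective_iff P).2 hP)

lemma rTorFree_denseR_functor_obj (e : ModuleCat.{u} Rᵐᵒᵖ ≌ ModuleCat.{u} Sᵐᵒᵖ)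
    {X : ModuleCat.{u} Rᵐᵒᵖ} (hX : RTorFree (denseR R) X) :
    RTorFree (denseR S) (e.functor.obj X) := by
  rw [rTorFree_denseR_iff] at hX ⊢
  intro Y f hY
  have := Functor.preservesZeroMorphisms_of_full e.inverse
  apply e.inverse.map_injective
  have hiso : IsIso (e.unitIso.inv.app X) := NatIso.inv_app_isIso e.unitIso X
  have hmono : Mono (e.unitIso.inv.app X) := IsIso.mono_of_iso _
  rw [Functor.map_zero, ← cancel_mono (e.unitIso.inv.app X), Limits.zero_comp]
  exact hX _ _ (rTor_denseR_functor_obj e.symm hY)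

/-- **Statement 8.** An equivalence `Mod-R ≌ Mod-S` sends the Gabriel filter of dense
right ideals of `R` to that of dense right ideals of `S` (characterized by the transport
of the associated torsion theories). -/
theorem equivalence_preserves_dense (e : ModuleCat.{u} Rᵐᵒᵖ ≌ ModuleCat.{u} Sᵐᵒᵖ) :
    ∀ X : ModuleCat.{u} Rᵐᵒᵖ,
      (RTor (denseR R) X → RTor (denseR S) (e.functor.obj X)) ∧
      (RTorFree (denseR R) X → RTorFree (denseR S) (e.functor.obj X)) := by
  exact fun _ => ⟨rTor_denseR_functor_obj e, rTorFree_denseR_functor_obj e⟩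

end Stmt8
end

section
/- Let R be a unital commutative ring and let S be a saturated multiplicative set of regular elements (nonzero divisors) of R. Then the sequence 0 → U(R) → U(RS⁻¹) → Pic(R | RS⁻¹) → Pic_R(R) → Pic_{RS⁻¹}(RS⁻¹) is exact, where U denotes the group of units, Pic(R | RS⁻¹) is the group of R-submodules M of RS⁻¹ (stable under both multiplications) with M M⁻¹ = R where M⁻¹ = {n ∈ RS⁻¹ : nM ⊆ R}, the map U(RS⁻¹) → Pic(R | RS⁻¹) sends x ↦ xR, the next map sends M to its class as an invertible R-module, and the last map sends [M] ↦ [M ⊗_R RS⁻¹] = [MS⁻¹]. -/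
open scoped TensorProduct

universe u

set_option autoImplicit false

/-! ## Statement 19

Let `R` be a commutative unital ring and `S` a saturated multiplicative set of regular
elements of `R`. Then the sequence
`0 → U(R) → U(RS⁻¹) → Pic(R | RS⁻¹) → Pic_R(R) → Pic_{RS⁻¹}(RS⁻¹)`
is exact, where `Pic(R | RS⁻¹)` is the group of `R`-submodules `M ⊆ RS⁻¹` with
`M M⁻¹ = R`, `M⁻¹ = {n ∈ RS⁻¹ : nM ⊆ R}`. Exactness is expressed pointwise. -/

section Stmt19
variable {R : Type u} [CommRing R]

/-- Data exhibiting an `R`-module `P` as invertible: a module `P'` and an `R`-module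
isomorphism `P ⊗_R P' ≅ R`. -/
structure ModInvData (P : Type u) [AddCommGroup P] [Module R P] where
  P' : Type u
  [accP' : AddCommGroup P']
  [modP' : Module R P']
  pair : TensorProduct R P P' → R
  pair_add : ∀ z w, pair (z + w) = pair z + pair w
  pair_lin : ∀ (r : R) (x : P) (y : P'), pair ((r • x) ⊗ₜ[R] y) = r * pair (x ⊗ₜ[R] y)
  pair_bij : Function.Bijective pair

namespace Submodule

variable {A : Type*} [CommSemiring A] [Algebra R A]

/-- A submodule `M` with `M * (1 / M) = 1` as a unit of the semiring of submodules. -/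
def unitOfMulOneDiv (M : Submodule R A) (h : M * (1 / M) = 1) : (Submodule R A)ˣ :=
  ⟨M, 1 / M, h, by rw [mul_comm, h]⟩

theorem mul_one_div_of_unit (I : (Submodule R A)ˣ) : (I : Submodule R A) * (1 / I) = 1 := by
  refine le_antisymm mul_one_div_le_one ?_
  calc 1 = (I : Submodule R A) * ↑I⁻¹ := I.mul_inv.symm
    _ ≤ I * (1 / I) := mul_le_mul_right (le_div_iff_mul_le.mpr I.inv_mul.le) _

open CommRing

variable [FaithfulSMul R A]

theorem nonempty_linearEquiv_self_iff_eq_span_singleton {M : Submodule R A}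
    (h : M * (1 / M) = 1) : Nonempty (M ≃ₗ[R] R) ↔ ∃ x : Aˣ, M = span R {(x : A)} := by
  have key := SetLike.ext_iff.mp (ker_unitsToPic R A) (unitOfMulOneDiv M h)
  rw [MonoidHom.mem_ker, unitsToPic_apply, Pic.mk_eq_one_iff] at key
  refine key.trans ⟨fun ⟨x, hx⟩ ↦ ⟨x, ?_⟩, fun ⟨x, hx⟩ ↦ ⟨x, Units.ext ?_⟩⟩
  · exact congr_arg Units.val hx.symm
  · exact hx.symm

theorem nonempty_baseChange_linearEquiv_iff {P : Type*} [AddCommMonoid P] [Module R P]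
    [Module.Invertible R P] :
    Nonempty (A ⊗[R] P ≃ₗ[A] A) ↔
      ∃ M : Submodule R A, M * (1 / M) = 1 ∧ Nonempty (P ≃ₗ[R] M) := by
  let e : A ⊗[R] Pic.mk R P ≃ₗ[A] A ⊗[R] P :=
    TensorProduct.AlgebraTensorModule.congr (.refl A A) (Pic.mk.linearEquiv R P)
  have key := SetLike.ext_iff.mp (range_unitsToPic R A) (Pic.mk R P)
  rw [relPic, MonoidHom.mem_ker, Pic.mapAlgebra_apply, Pic.mk_eq_one_iff] at key
  refine (show Nonempty (A ⊗[R] P ≃ₗ[A] A) ↔ _ from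
    ⟨fun ⟨f⟩ ↦ ⟨e ≪≫ₗ f⟩, fun ⟨f⟩ ↦ ⟨e.symm ≪≫ₗ f⟩⟩).trans (key.symm.trans ⟨?_, ?_⟩)
  · rintro ⟨I, hI⟩
    exact ⟨I, mul_one_div_of_unit I, Pic.mk_eq_mk_iff.mp hI.symm⟩
  · rintro ⟨M, hM, hP⟩
    have : Module.Invertible R M := .congr hP.some
    exact ⟨unitOfMulOneDiv M hM, (Pic.mk_eq_mk_iff.mpr hP).symm⟩

end Submodule

theorem ModInvData.invertible {P : Type u} [AddCommGroup P] [Module R P]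
    (D : ModInvData (R := R) P) : Module.Invertible R P := by
  obtain ⟨P', pair, hadd, hlin, hbij⟩ := D
  let f : P ⊗[R] P' →ₗ[R] R :=
    { toFun := pair
      map_add' := hadd
      map_smul' := fun r z ↦ by
        have h0 : pair 0 = 0 := by simpa using hadd 0 0
        induction z with
        | zero => simp [h0]
        | tmul x y => simpa [TensorProduct.smul_tmul'] using hlin r x y
        | add z w hz hw => rw [smul_add, hadd, hz, hw, hadd, smul_add] }
  exact .left (LinearEquiv.ofBijective f hbij)

/-- **Statement 19.** The exact sequence
`0 → U(R) → U(RS⁻¹) → Pic(R | RS⁻¹) → Pic_R(R) → Pic_{RS⁻¹}(RS⁻¹)` for a saturated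
multiplicative set `S` of regular elements of a commutative ring `R`. -/
theorem pic_exact_sequence_commutative (S : Submonoid R)
    (hsat : ∀ a b : R, a * b ∈ S → a ∈ S ∧ b ∈ S)
    (hreg : ∀ s ∈ S, IsRegular s) :
    -- exactness at `U(R)`: `U(R) → U(RS⁻¹)` is injective
    (∀ u v : Rˣ,
      algebraMap R (Localization S) u = algebraMap R (Localization S) v → u = v) ∧
    -- exactness at `U(RS⁻¹)`: a unit `x` comes from `U(R)` iff `xR = R` in `RS⁻¹`
    (∀ x : (Localization S)ˣ,
      (∃ u : Rˣ, algebraMap R (Localization S) u = x) ↔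
        Submodule.span R {(x : Localization S)} = (1 : Submodule R (Localization S))) ∧
    -- exactness at `Pic(R | RS⁻¹)`: an invertible `R`-submodule `M ⊆ RS⁻¹` is trivial in
    -- `Pic_R(R)` iff `M = xR` for a unit `x` of `RS⁻¹`
    (∀ M : Submodule R (Localization S), M * (1 / M) = 1 →
      (Nonempty (M ≃ₗ[R] R) ↔
        ∃ x : (Localization S)ˣ, M = Submodule.span R {(x : Localization S)})) ∧
    -- exactness at `Pic_R(R)`: an invertible `R`-module `P` becomes trivial over `RS⁻¹`
    -- iff it is isomorphic to an invertible `R`-submodule of `RS⁻¹`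
    (∀ (P : Type u) [AddCommGroup P] [Module R P], ModInvData (R := R) P →
      (Nonempty
          ((TensorProduct R (Localization S) P) ≃ₗ[Localization S] Localization S) ↔
        ∃ M : Submodule R (Localization S), M * (1 / M) = 1 ∧ Nonempty (P ≃ₗ[R] M))) := by
  have hinj : Function.Injective (algebraMap R (Localization S)) :=
    IsLocalization.injectiveₛ (M := S) _ hreg
  have : FaithfulSMul R (Localization S) := (faithfulSMul_iff_algebraMap_injective _ _).mpr hinj
  refine ⟨fun u v h ↦ Units.ext (hinj h), fun x ↦ ?_,
    fun M hM ↦ Submodule.nonempty_linearEquiv_self_iff_eq_span_singleton hM, fun P _ _ D ↦ ?_⟩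
  · simp_rw [Submodule.span_singleton_eq_one_iff, eq_comm]
  · have := D.invertible
    exact Submodule.nonempty_baseChange_linearEquiv_iff

end Stmt19
end
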